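/- Let I ⊂ S = K[x_1,…,x_n] be a monomial ideal and let S̄ = S[y] be the polynomial ring in one additional variable. If sdepth_{S̄}((I, y)) = sdepth_S(I), then sdepth_S(I) ≥ sdepth_S(S/I) + 1. -/

import Mathlib

open MvPolynomial

/-- The `K`-subspace `m·K[Z]` of `S = K[x_0,…,x_{n-1}]`, where `m` is the monomial with
exponent vector `a` and `Z` is a set of variables: the span of all monomials `m·w`
with `w` a monomial in the variables of `Z`. -/
noncomputable def StanleySpace (K : Type*) [Field K] {n : ℕ} (a : Fin n →₀ ℕ)
    (Z : Finset (Fin n)) : Submodule K (MvPolynomial (Fin n) K) :=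
  Submodule.span K
    {p | ∃ c : Fin n →₀ ℕ, c.support ⊆ Z ∧ p = monomial (a + c) (1 : K)}

/-- `I` is a monomial ideal, i.e. an ideal generated by monomials. -/
def IsMonomialIdeal {K : Type*} [Field K] {n : ℕ}
    (I : Ideal (MvPolynomial (Fin n) K)) : Prop :=
  ∃ G : Set (Fin n →₀ ℕ), I = Ideal.span ((fun a => monomial a (1 : K)) '' G)

/-- The `K`-subspace of `S` spanned by the monomials lying in `I` but not in `J`.
For monomial ideals `J ⊆ I` this is the canonical `K`-vector space representative
of the `ℤⁿ`-graded module `I/J` inside `S`. -/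
noncomputable def monomialSpan (K : Type*) [Field K] {n : ℕ}
    (I J : Ideal (MvPolynomial (Fin n) K)) : Submodule K (MvPolynomial (Fin n) K) :=
  Submodule.span K
    {p | ∃ a : Fin n →₀ ℕ, p = monomial a (1 : K) ∧
      monomial a (1 : K) ∈ I ∧ monomial a (1 : K) ∉ J}

/-- The family `(a i, Z i), i = 1,…,r` is a Stanley decomposition of the module `I/J`
(represented by the span of the monomials of `I \ J`): the Stanley spaces
`(a i)·K[Z i]` are independent and their (direct) sum is all of `I/J`. -/
def IsStanleyDecomp (K : Type*) [Field K] {n r : ℕ}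
    (I J : Ideal (MvPolynomial (Fin n) K))
    (a : Fin r → (Fin n →₀ ℕ)) (Z : Fin r → Finset (Fin n)) : Prop :=
  iSupIndep (fun i => StanleySpace K (a i) (Z i)) ∧
    (⨆ i, StanleySpace K (a i) (Z i)) = monomialSpan K I J

/-- The Stanley depth `sdepth_S (I/J)` of the module `I/J`, where `J ⊆ I ⊆ S` are
monomial ideals: the largest `d` such that there is a Stanley decomposition of `I/J`
all of whose Stanley spaces use at least `d` variables.  (As `ℕ∞`: the Stanley depth
of the zero module, which admits the empty decomposition, is `⊤`.)
`sdepth K I ⊥` is `sdepth_S I` and `sdepth K ⊤ I` is `sdepth_S (S/I)`. -/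
noncomputable def sdepth (K : Type*) [Field K] {n : ℕ}
    (I J : Ideal (MvPolynomial (Fin n) K)) : ℕ∞ :=
  sSup {d : ℕ∞ | ∃ (r : ℕ) (a : Fin r → (Fin n →₀ ℕ)) (Z : Fin r → Finset (Fin n)),
    IsStanleyDecomp K I J a Z ∧ ∀ i, d ≤ ((Z i).card : ℕ∞)}

/-- The depth `depth_S M` of an `S`-module `M` with respect to the maximal graded
ideal `(x_0,…,x_{n-1})`: the supremum of the lengths of `M`-regular sequences
contained in that ideal. -/
noncomputable def gradedDepth (K : Type*) [Field K] (n : ℕ) (M : Type*)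
    [AddCommGroup M] [Module (MvPolynomial (Fin n) K) M] : ℕ∞ :=
  sSup {k : ℕ∞ | ∃ rs : List (MvPolynomial (Fin n) K), (rs.length : ℕ∞) = k ∧
    (∀ x ∈ rs, x ∈ Ideal.span (Set.range (X : Fin n → MvPolynomial (Fin n) K))) ∧
    RingTheory.Sequence.IsRegular M rs}

/-- Extension of an ideal along an inclusion of polynomial rings induced by a map
of variables (`IS`, for `f` injective). -/
noncomputable def extIdeal {K : Type*} [Field K] {m n : ℕ} (f : Fin m → Fin n)
    (I : Ideal (MvPolynomial (Fin m) K)) : Ideal (MvPolynomial (Fin n) K) :=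
  Ideal.map (rename f : MvPolynomial (Fin m) K →ₐ[K] MvPolynomial (Fin n) K) I

/-- The inclusion of the variables of `S'' = K[x_{r+1},…,x_n]` into those of
`S = K[x_1,…,x_n]` (variables indexed from `0`). -/
def sndEmbed {n r : ℕ} (h : r ≤ n) : Fin (n - r) → Fin n :=
  fun i => ⟨r + i.1, by have := i.2; omega⟩

/-- The inclusion of the variables of `S'' = K[x_s,…,x_n]` into those of
`S = K[x_1,…,x_n]` (variables indexed from `0`). -/
def midEmbed {n s : ℕ} (hs : 1 ≤ s) (hsn : s ≤ n) : Fin (n + 1 - s) → Fin n :=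
  fun i => ⟨s - 1 + i.1, by have := i.2; omega⟩

/-- The exponent vectors of the monomials in the Stanley space `StanleySpace K a Z`. -/
def stanleyBox {n : ℕ} (a : Fin n →₀ ℕ) (Z : Finset (Fin n)) : Set (Fin n →₀ ℕ) :=
  {b | a ≤ b ∧ ∀ i ∉ Z, b i = a i}

lemma stanleySpace_eq_span_image (K : Type*) [Field K] {n : ℕ} (a : Fin n →₀ ℕ)
    (Z : Finset (Fin n)) :
    StanleySpace K a Z = Submodule.span K (basisMonomials (Fin n) K '' stanleyBox a Z) := by
  unfold StanleySpace
  congr 1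
  ext p
  simp only [Set.mem_ofPred_eq, Set.mem_image, coe_basisMonomials]
  constructor
  · rintro ⟨c, hc, rfl⟩
    refine ⟨a + c, ⟨le_self_add, fun i hi => ?_⟩, rfl⟩
    have : c i = 0 := Finsupp.notMem_support_iff.1 fun h => hi (hc h)
    simp [this]
  · rintro ⟨b, ⟨hab, hb⟩, rfl⟩
    refine ⟨b - a, fun i hi => ?_, by rw [add_tsub_cancel_of_le hab]⟩
    by_contra hiZ
    simp [hb i hiZ] at hi

lemma monomialSpan_eq_span_image (K : Type*) [Field K] {n : ℕ}
    (I J : Ideal (MvPolynomial (Fin n) K)) :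
    monomialSpan K I J = Submodule.span K (basisMonomials (Fin n) K ''
      {a | monomial a (1 : K) ∈ I ∧ monomial a (1 : K) ∉ J}) := by
  unfold monomialSpan
  congr 1
  ext p
  simp only [Set.mem_ofPred_eq, Set.mem_image, coe_basisMonomials]
  exact ⟨fun ⟨a, hp, ha⟩ => ⟨a, ha, hp.symm⟩, fun ⟨a, ha, hp⟩ => ⟨a, hp.symm, ha⟩⟩

lemma Module.Basis.mem_span_image_iff_mem {ι R M : Type*} [Ring R] [Nontrivial R]
    [AddCommGroup M] [Module R M] (v : Module.Basis ι R M) {s : Set ι} {x : ι} :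
    v x ∈ Submodule.span R (v '' s) ↔ x ∈ s :=
  ⟨fun h => by_contra fun hx => v.linearIndependent.notMem_span_image hx h,
    fun h => Submodule.subset_span ⟨x, h, rfl⟩⟩

lemma Module.Basis.iSupIndep_span_image_iff {ι κ R M : Type*} [Ring R] [Nontrivial R]
    [AddCommGroup M] [Module R M] (v : Module.Basis ι R M) (s : κ → Set ι) :
    iSupIndep (fun i => Submodule.span R (v '' s i)) ↔
      Pairwise fun i j => Disjoint (s i) (s j) := by
  constructor
  · intro h i j hij
    rw [Set.disjoint_left]
    intro x hi hj
    exact v.ne_zero x (Submodule.disjoint_def.1 (h.pairwiseDisjoint hij) _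
      (Submodule.subset_span ⟨x, hi, rfl⟩) (Submodule.subset_span ⟨x, hj, rfl⟩))
  · intro h i
    simp only [← Submodule.span_iUnion, ← Set.image_iUnion]
    refine v.linearIndependent.disjoint_span_image ?_
    simp only [Set.disjoint_iUnion_right]
    exact fun j hj => h hj.symm

/-- A Stanley decomposition is a partition of the set of exponents into Stanley boxes. -/
lemma isStanleyDecomp_iff (K : Type*) [Field K] {n r : ℕ}
    (I J : Ideal (MvPolynomial (Fin n) K)) (a : Fin r → (Fin n →₀ ℕ))
    (Z : Fin r → Finset (Fin n)) :
    IsStanleyDecomp K I J a Z ↔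
      (Pairwise fun i j => Disjoint (stanleyBox (a i) (Z i)) (stanleyBox (a j) (Z j))) ∧
      ⋃ i, stanleyBox (a i) (Z i) =
        {b | monomial b (1 : K) ∈ I ∧ monomial b (1 : K) ∉ J} := by
  unfold IsStanleyDecomp
  simp only [stanleySpace_eq_span_image, monomialSpan_eq_span_image]
  rw [Module.Basis.iSupIndep_span_image_iff, ← Submodule.span_iUnion, ← Set.image_iUnion]
  refine and_congr_right fun _ => ⟨fun h => ?_, fun h => by rw [h]⟩
  ext x
  rw [← (basisMonomials (Fin n) K).mem_span_image_iff_mem, h,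
    (basisMonomials (Fin n) K).mem_span_image_iff_mem]

lemma exists_isStanleyDecomp_of_finite (K : Type*) [Field K] {n : ℕ} {ι : Type*} [Finite ι]
    {I J : Ideal (MvPolynomial (Fin n) K)} (a : ι → (Fin n →₀ ℕ)) (Z : ι → Finset (Fin n))
    (hdisj : Pairwise fun i j => Disjoint (stanleyBox (a i) (Z i)) (stanleyBox (a j) (Z j)))
    (hunion : ⋃ i, stanleyBox (a i) (Z i) =
      {b | monomial b (1 : K) ∈ I ∧ monomial b (1 : K) ∉ J})
    {d : ℕ∞} (hd : ∀ i, d ≤ ((Z i).card : ℕ∞)) :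
    ∃ (r : ℕ) (a : Fin r → (Fin n →₀ ℕ)) (Z : Fin r → Finset (Fin n)),
      IsStanleyDecomp K I J a Z ∧ ∀ i, d ≤ ((Z i).card : ℕ∞) := by
  let e := Finite.equivFin ι
  refine ⟨Nat.card ι, a ∘ e.symm, Z ∘ e.symm, (isStanleyDecomp_iff K I J _ _).2
    ⟨fun i j hij => hdisj (e.symm.injective.ne hij), ?_⟩, fun i => hd _⟩
  rw [← hunion]
  exact e.symm.surjective.iUnion_comp fun i => stanleyBox (a i) (Z i)

lemma monomial_mem_ideal_span_monomial_image {σ R : Type*} [CommSemiring R] [Nontrivial R]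
    {b : σ →₀ ℕ} {G : Set (σ →₀ ℕ)} :
    monomial b (1 : R) ∈ Ideal.span ((fun a => monomial a (1 : R)) '' G) ↔
      ∃ g ∈ G, g ≤ b := by
  classical
  simp [mem_ideal_span_monomial_image, support_monomial]

lemma IsMonomialIdeal.exists_finset {K : Type*} [Field K] {n : ℕ}
    {I : Ideal (MvPolynomial (Fin n) K)} (hI : IsMonomialIdeal I) :
    ∃ G : Finset (Fin n →₀ ℕ), ∀ b, monomial b (1 : K) ∈ I ↔ ∃ g ∈ G, g ≤ b := by
  obtain ⟨G, rfl⟩ := hI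
  obtain ⟨t, ht, hspan⟩ := (Submodule.fg_span_iff_fg_span_finset_subset _).1
    (IsNoetherian.noetherian (Ideal.span ((fun a => monomial a (1 : K)) '' G)))
  classical
  obtain ⟨G', -, rfl⟩ := Finset.subset_set_image_iff.1 ht
  refine ⟨G', fun b => ?_⟩
  have : Ideal.span ((fun a => monomial a (1 : K)) '' G) =
      Ideal.span ((fun a => monomial a (1 : K)) '' (G' : Set (Fin n →₀ ℕ))) := by
    simpa using hspan
  rw [this, monomial_mem_ideal_span_monomial_image]
  simp

lemma mem_stanleyBox_filter_iff {n : ℕ} {b c g : Fin n →₀ ℕ} (hb : b ≤ g) :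
    c ∈ stanleyBox b {i | b i = g i} ↔ c ⊓ g = b := by
  simp only [stanleyBox, Set.mem_ofPred_eq, Finset.mem_filter, Finset.mem_univ, true_and,
    Finsupp.le_def, Finsupp.ext_iff, Finsupp.inf_apply]
  rw [← forall_and]
  refine forall_congr' fun i => ?_
  have := hb i
  omega

/-- If membership in `I` and in `J` only depends on the exponents truncated at `g`, then `I/J`
has a Stanley decomposition. -/
lemma exists_isStanleyDecomp (K : Type*) [Field K] {n : ℕ}
    {I J : Ideal (MvPolynomial (Fin n) K)} (g : Fin n →₀ ℕ)
    (hI : ∀ b, monomial (b ⊓ g) (1 : K) ∈ I ↔ monomial b (1 : K) ∈ I)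
    (hJ : ∀ b, monomial (b ⊓ g) (1 : K) ∈ J ↔ monomial b (1 : K) ∈ J) :
    ∃ (r : ℕ) (a : Fin r → (Fin n →₀ ℕ)) (Z : Fin r → Finset (Fin n)),
      IsStanleyDecomp K I J a Z ∧ ∀ i, (0 : ℕ∞) ≤ ((Z i).card : ℕ∞) := by
  let P : Set (Fin n →₀ ℕ) :=
    {b | b ≤ g ∧ monomial b (1 : K) ∈ I ∧ monomial b (1 : K) ∉ J}
  have : Finite P := ((Set.finite_Iic g).subset fun b hb => hb.1).to_subtype
  refine exists_isStanleyDecomp_of_finite K (fun b : P => (b : Fin n →₀ ℕ))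
    (fun b => {i | (b : Fin n →₀ ℕ) i = g i}) ?_ ?_ fun _ => zero_le
  · intro b b' hbb'
    rw [Set.disjoint_left]
    intro c hc hc'
    rw [mem_stanleyBox_filter_iff b.2.1] at hc
    rw [mem_stanleyBox_filter_iff b'.2.1] at hc'
    exact hbb' (Subtype.ext (hc.symm.trans hc'))
  · ext c
    simp only [Set.mem_iUnion, Set.mem_ofPred_eq]
    constructor
    · rintro ⟨b, hb⟩
      rw [mem_stanleyBox_filter_iff b.2.1] at hb
      rw [← hI, ← hJ, hb]
      exact b.2.2
    · rw [← hI, ← hJ]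
      exact fun hc => ⟨⟨c ⊓ g, inf_le_right, hc⟩,
        (mem_stanleyBox_filter_iff inf_le_right).2 rfl⟩

lemma IsMonomialIdeal.exists_truncation {K : Type*} [Field K] {n : ℕ}
    {I : Ideal (MvPolynomial (Fin n) K)} (hI : IsMonomialIdeal I) :
    ∃ g : Fin n →₀ ℕ, ∀ b, monomial (b ⊓ g) (1 : K) ∈ I ↔ monomial b (1 : K) ∈ I := by
  obtain ⟨G, hG⟩ := hI.exists_finset
  refine ⟨G.sup id, fun b => ?_⟩
  rw [hG, hG]
  refine exists_congr fun g => and_congr_right fun hg => ?_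
  exact le_inf_iff.trans (and_iff_left (Finset.le_sup (f := id) hg))

lemma IsMonomialIdeal.sdepth_le {K : Type*} [Field K] {n : ℕ}
    {I : Ideal (MvPolynomial (Fin n) K)} (hI : IsMonomialIdeal I) (h0 : I ≠ ⊥) :
    sdepth K I ⊥ ≤ n := by
  refine sSup_le ?_
  rintro d ⟨r, a, Z, hdec, hd⟩
  obtain ⟨G, rfl⟩ := hI
  obtain ⟨g, hg⟩ : G.Nonempty := by
    rw [Set.nonempty_iff_ne_empty]
    rintro rfl
    simp at h0
  have hmem : g ∈ ⋃ i, stanleyBox (a i) (Z i) := by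
    rw [((isStanleyDecomp_iff K _ _ a Z).1 hdec).2]
    exact ⟨Ideal.subset_span ⟨g, hg, rfl⟩, by simp⟩
  obtain ⟨i, -⟩ := Set.mem_iUnion.1 hmem
  refine (hd i).trans ?_
  exact_mod_cast (Finset.card_le_univ (Z i)).trans_eq (Fintype.card_fin n)

lemma monomial_mem_extIdeal_castSucc_sup_span_X_last_iff {K : Type*} [Field K] {n : ℕ}
    {I : Ideal (MvPolynomial (Fin n) K)} (hI : IsMonomialIdeal I) (b : Fin (n + 1) →₀ ℕ) :
    monomial b (1 : K) ∈ extIdeal Fin.castSucc I ⊔ Ideal.span {X (Fin.last n)} ↔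
      monomial (b.comapDomain Fin.castSucc (Fin.castSucc_injective n).injOn) (1 : K) ∈ I ∨
        1 ≤ b (Fin.last n) := by
  obtain ⟨G, rfl⟩ := hI
  have hspan : extIdeal Fin.castSucc (Ideal.span ((fun a => monomial a (1 : K)) '' G)) ⊔
      Ideal.span {X (Fin.last n)} = Ideal.span ((fun a => monomial a (1 : K)) ''
        ((Finsupp.mapDomain Fin.castSucc '' G) ∪ {Finsupp.single (Fin.last n) 1})) := by
    rw [extIdeal, Ideal.map_span, Set.image_union, Ideal.span_union, Set.image_image,
      Set.image_image, Set.image_singleton]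
    simp [rename_monomial, X]
  rw [hspan, monomial_mem_ideal_span_monomial_image, monomial_mem_ideal_span_monomial_image]
  simp only [Set.mem_union, Set.mem_image, Set.mem_singleton_iff, or_and_right, exists_or,
    exists_eq_left, Finsupp.single_le_iff]
  refine or_congr_left ?_
  rw [exists_exists_and_eq_and]
  refine exists_congr fun g => and_congr_right fun _ => ?_
  simp only [Finsupp.le_def, Fin.forall_fin_succ', Finsupp.comapDomain_apply,
    Finsupp.mapDomain_apply (Fin.castSucc_injective n)]
  rw [Finsupp.mapDomain_of_notMem_range]
  · simp
  · simp

/-- Multiplying by `y ^ k` and adjoining `y` as a free variable. -/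
lemma mem_stanleyBox_cons_last_iff {n : ℕ} (a : Fin n →₀ ℕ) (Z : Finset (Fin n)) (k : ℕ)
    (b : Fin (n + 1) →₀ ℕ) :
    b ∈ stanleyBox (a.mapDomain Fin.castSucc + Finsupp.single (Fin.last n) k)
        (Finset.cons (Fin.last n) (Z.map Fin.castSuccEmb) (by simp)) ↔
      b.comapDomain Fin.castSucc (Fin.castSucc_injective n).injOn ∈ stanleyBox a Z ∧
        k ≤ b (Fin.last n) := by
  have hlast : a.mapDomain Fin.castSucc (Fin.last n) = 0 :=
    Finsupp.mapDomain_of_notMem_range _ _ (by simp)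
  simp only [stanleyBox, Set.mem_ofPred_eq, Finsupp.le_def, Fin.forall_fin_succ',
    Finsupp.comapDomain_apply, Finsupp.add_apply,
    Finsupp.mapDomain_apply (Fin.castSucc_injective n), hlast]
  simp [and_right_comm]

/-- `(I, y) = I S[y] ⊕ y (S/I)[y]`, so Stanley decompositions of `I` and `S/I` yield one of
`(I, y)`. -/
lemma IsMonomialIdeal.min_add_one_le_sdepth {K : Type*} [Field K] {n : ℕ}
    {I : Ideal (MvPolynomial (Fin n) K)} (hI : IsMonomialIdeal I)
    {r s : ℕ} {a : Fin r → (Fin n →₀ ℕ)} {Z : Fin r → Finset (Fin n)}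
    {a' : Fin s → (Fin n →₀ ℕ)} {Z' : Fin s → Finset (Fin n)} {d d' : ℕ∞}
    (hdec : IsStanleyDecomp K I ⊥ a Z) (hd : ∀ i, d ≤ ((Z i).card : ℕ∞))
    (hdec' : IsStanleyDecomp K ⊤ I a' Z') (hd' : ∀ i, d' ≤ ((Z' i).card : ℕ∞)) :
    min (d + 1) (d' + 1) ≤
      sdepth K (extIdeal Fin.castSucc I ⊔ Ideal.span {X (Fin.last n)}) ⊥ := by
  rw [isStanleyDecomp_iff] at hdec hdec'
  obtain ⟨hdisj, hunion⟩ := hdec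
  obtain ⟨hdisj', hunion'⟩ := hdec'
  have hmem : ∀ c, (∃ i, c ∈ stanleyBox (a i) (Z i)) ↔ monomial c (1 : K) ∈ I := fun c => by
    simpa using Set.ext_iff.1 hunion c
  have hmem' : ∀ c, (∃ i, c ∈ stanleyBox (a' i) (Z' i)) ↔ monomial c (1 : K) ∉ I := fun c => by
    simpa using Set.ext_iff.1 hunion' c
  refine le_sSup (exists_isStanleyDecomp_of_finite K (ι := Fin r ⊕ Fin s)
    (fun i => (Sum.elim a a' i).mapDomain Fin.castSucc +
      Finsupp.single (Fin.last n) (Sum.elim (fun _ => 0) (fun _ => 1) i))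
    (fun i => Finset.cons (Fin.last n) ((Sum.elim Z Z' i).map Fin.castSuccEmb) (by simp))
    ?_ ?_ ?_)
  · intro i j hij
    rw [Set.disjoint_left]
    intro b hb hb'
    rw [mem_stanleyBox_cons_last_iff] at hb hb'
    rcases i with i | i <;> rcases j with j | j
    · exact Set.disjoint_left.1 (hdisj fun h => hij (congrArg _ h)) hb.1 hb'.1
    · exact (hmem' _).1 ⟨j, hb'.1⟩ ((hmem _).1 ⟨i, hb.1⟩)
    · exact (hmem' _).1 ⟨i, hb.1⟩ ((hmem _).1 ⟨j, hb'.1⟩)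
    · exact Set.disjoint_left.1 (hdisj' fun h => hij (congrArg _ h)) hb.1 hb'.1
  · ext b
    simp only [Set.mem_iUnion, mem_stanleyBox_cons_last_iff, Sum.exists, Sum.elim_inl,
      Sum.elim_inr, exists_and_right, hmem, hmem', Set.mem_ofPred_eq,
      monomial_mem_extIdeal_castSucc_sup_span_X_last_iff hI]
    simp only [zero_le, and_true, Ideal.mem_bot, monomial_eq_zero, one_ne_zero, not_false_eq_true]
    tauto
  · rintro (i | i)
    · refine (min_le_left _ _).trans ?_
      simpa using hd i
    · refine (min_le_right _ _).trans ?_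
      simpa using hd' i

/-- Let `I ⊂ S = K[x_1,…,x_n]` be a monomial ideal and `S̄ = S[y]`.
If `sdepth_{S̄}((I, y)) = sdepth_S(I)` then `sdepth_S(I) ≥ sdepth_S(S/I) + 1`. -/
theorem sdepth_ge_sdepth_quot_add_one_of_sdepth_adjoin_eq {K : Type*} [Field K] {n : ℕ}
    (I : Ideal (MvPolynomial (Fin n) K))
    (hm : IsMonomialIdeal I) (h0 : I ≠ ⊥) (h1 : I ≠ ⊤)
    (h : sdepth K (extIdeal Fin.castSucc I ⊔ Ideal.span {X (Fin.last n)}) ⊥ =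
      sdepth K I ⊥) :
    sdepth K I ⊥ ≥ sdepth K ⊤ I + 1 := by
  obtain ⟨g, hg⟩ := hm.exists_truncation
  have hlt : sdepth K I ⊥ < ⊤ := (hm.sdepth_le h0).trans_lt (ENat.natCast_lt_top n)
  have hneI := exists_isStanleyDecomp K (I := I) (J := ⊥) g hg (by simp)
  have : Nonempty {d : ℕ∞ | ∃ (r : ℕ) (a : Fin r → (Fin n →₀ ℕ)) (Z : Fin r → Finset (Fin n)),
      IsStanleyDecomp K I ⊥ a Z ∧ ∀ i, d ≤ ((Z i).card : ℕ∞)} := ⟨0, hneI⟩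
  obtain ⟨r, a, Z, hdec, hd⟩ := ENat.sSup_mem_of_nonempty_of_lt_top hlt
  change ∀ i, sdepth K I ⊥ ≤ _ at hd
  let D : Set ℕ∞ := {d | ∃ (r : ℕ) (a : Fin r → (Fin n →₀ ℕ)) (Z : Fin r → Finset (Fin n)),
    IsStanleyDecomp K ⊤ I a Z ∧ ∀ i, d ≤ ((Z i).card : ℕ∞)}
  have key : ∀ d' ∈ D, d' + 1 ≤ sdepth K I ⊥ := by
    rintro d' ⟨s, a', Z', hdec', hd'⟩
    have hmin := hm.min_add_one_le_sdepth hdec hd hdec' hd'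
    rw [h, min_le_iff] at hmin
    exact hmin.resolve_left (ENat.lt_add_one_iff hlt.ne |>.2 le_rfl).not_ge
  have : Nonempty D := ⟨0, exists_isStanleyDecomp K (I := ⊤) (J := I) g (by simp) hg⟩
  refine key _ (ENat.sSup_mem_of_nonempty_of_lt_top (s := D) ?_)
  exact (sSup_le fun d' hd' => le_self_add.trans (key d' hd')).trans_lt hlt
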